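/- There are absolute constants 0 < γ < 1 and η > 0 such that for every positive integer k, the probability (with respect to P) that there exists some a ∈ A_γ^k with |k^{-1} Σ_{j=1}^k |Σ_{i=1}^k a_i ε_{i,j}| − E_1(a)| > E_1(a)/2 is at most e^{−η k}. -/

import Mathlib

open Finset

/-- The sign `±1` associated to a boolean. -/
noncomputable def sgn (b : Bool) : ℝ := if b then 1 else -1

open scoped Classical in
/-- The probability, under the uniform measure on sign arrays
`{ε_{i,j}}_{i,j=1}^k ∈ {−1,1}^{k²}`, of an event `pred`. -/
noncomputable def signProb (k : ℕ) (pred : (Fin k → Fin k → Bool) → Prop) : ℝ :=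
  ((Finset.univ : Finset (Fin k → Fin k → Bool)).filter pred).card / 2 ^ (k * k)

/-- `E_1(a)`: the average over all sign arrays of `k⁻¹ ∑_j |∑_i a_i ε_{i,j}|`. -/
noncomputable def E1 (k : ℕ) (a : Fin k → ℝ) : ℝ :=
  (∑ ε : Fin k → Fin k → Bool, (k : ℝ)⁻¹ * ∑ j, |∑ i, a i * sgn (ε i j)|) / 2 ^ (k * k)

/-- `A_γ^k`: unit vectors `a` of `ℝ^k` with `k^{-1/2} ∑_i |a_i| ≤ γ`. -/
def Agk (k : ℕ) (γ : ℝ) : Set (Fin k → ℝ) :=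
  {a | (∑ i, a i ^ 2) = 1 ∧ (Real.sqrt k)⁻¹ * ∑ i, |a i| ≤ γ}


/-- linear form -/
noncomputable def XX (k : ℕ) (a : Fin k → ℝ) (e : Fin k → Bool) : ℝ := ∑ i, a i * sgn (e i)

/-- mean -/
noncomputable def mu (k : ℕ) (a : Fin k → ℝ) : ℝ := (∑ e, |XX k a e|) / 2 ^ k

/-- empirical -/
noncomputable def FF (k : ℕ) (ε : Fin k → Fin k → Bool) (a : Fin k → ℝ) : ℝ :=
  (k : ℝ)⁻¹ * ∑ j, |∑ i, a i * sgn (ε i j)|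

lemma col_sum (k : ℕ) (G : Fin k → (Fin k → Bool) → ℝ) :
    ∑ ε : Fin k → Fin k → Bool, ∏ j, G j (fun i => ε i j) = ∏ j, ∑ e, G j e := by
  rw [Finset.prod_univ_sum]
  simp only [Fintype.piFinset_univ]
  exact Fintype.sum_equiv (Equiv.piComm _) _ _ (fun ε => rfl)

lemma XX_exp (k : ℕ) (a : Fin k → ℝ) :
    ∑ e, Real.exp (XX k a e) ≤ 2 ^ k * Real.exp ((∑ i, a i ^ 2) / 2) := by
  have h : ∑ e, Real.exp (XX k a e) = ∏ i, ∑ b : Bool, Real.exp (a i * sgn b) := by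
    rw [Finset.prod_univ_sum]
    simp only [Fintype.piFinset_univ, XX, Real.exp_sum]
  rw [h, Finset.sum_div, Real.exp_sum]
  calc _ ≤ ∏ i : Fin k, (2 * Real.exp (a i ^ 2 / 2)) := by
        apply Finset.prod_le_prod
        · intros; positivity
        · intro i _
          have := Real.cosh_le_exp_half_sq (a i)
          rw [Real.cosh_eq] at this
          simp [sgn]
          linarith
    _ = _ := by rw [Finset.prod_mul_distrib]; simp

lemma XX_smul (k : ℕ) (a : Fin k → ℝ) (s : ℝ) (e) : XX k (fun i => s * a i) e = s * XX k a e := by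
  simp [XX, Finset.mul_sum, mul_assoc]

lemma XX_abs_exp (k : ℕ) (a : Fin k → ℝ) (ha : ∑ i, a i ^ 2 ≤ 1) (s : ℝ) (hs : 0 ≤ s) :
    ∑ e, Real.exp (s * |XX k a e|) ≤ 2 ^ k * (2 * Real.exp (s ^ 2 / 2)) := by
  have h1 := XX_exp k (fun i => s * a i)
  have h2 := XX_exp k (fun i => (-s) * a i)
  simp only [XX_smul] at h1 h2
  have h3 : ∀ e, Real.exp (s * |XX k a e|) ≤ Real.exp (s * XX k a e) + Real.exp (-s * XX k a e) := by
    intro e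
    rcases abs_cases (XX k a e) with h | h <;> rw [h.1]
    · linarith [Real.exp_pos (-s * XX k a e)]
    · rw [mul_neg, neg_mul]; linarith [Real.exp_pos (s * XX k a e)]
  have h4 : ∀ s : ℝ, Real.exp ((∑ i, (s * a i) ^ 2) / 2) ≤ Real.exp (s ^ 2 / 2) := by
    intro s
    apply Real.exp_le_exp.2
    simp only [mul_pow, ← Finset.mul_sum]
    nlinarith [sq_nonneg s]
  have h5 := h4 (-s)
  rw [neg_sq] at h5
  calc _ ≤ _ := Finset.sum_le_sum (fun e _ => h3 e)
    _ = _ := Finset.sum_add_distrib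
    _ ≤ 2 ^ k * Real.exp (s ^ 2 / 2) + 2 ^ k * Real.exp (s ^ 2 / 2) := by
      refine add_le_add (h1.trans ?_) (h2.trans ?_)
      · exact mul_le_mul_of_nonneg_left (h4 s) (by positivity)
      · exact mul_le_mul_of_nonneg_left h5 (by positivity)
    _ = _ := by ring

lemma E1_eq (k : ℕ) (hk : 0 < k) (a : Fin k → ℝ) : E1 k a = mu k a := by
  have h : ∀ j : Fin k, ∑ ε : Fin k → Fin k → Bool, |∑ i, a i * sgn (ε i j)|
      = (∑ e, |XX k a e|) * (2 ^ k) ^ (k - 1) := by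
    intro j
    have := col_sum k (fun j' e => if j' = j then |XX k a e| else 1)
    rw [← Finset.mul_prod_erase Finset.univ _ (Finset.mem_univ j)] at this
    rw [Finset.prod_congr rfl (g := fun _ => (2 : ℝ) ^ k)] at this
    · simp only [if_true] at this
      rw [Finset.prod_const, Finset.card_erase_of_mem (Finset.mem_univ j)] at this
      simp only [Finset.card_univ, Fintype.card_fin] at this
      rw [← this]
      apply Finset.sum_congr rfl
      intro ε _
      rw [Finset.prod_ite_eq' Finset.univ j]
      simp [XX]
    · intro x hx
      simp [Finset.ne_of_mem_erase hx]
  unfold E1 mu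
  rw [← Finset.mul_sum, Finset.sum_comm]
  simp only [h]
  have hk' : (k : ℝ) ≠ 0 := by positivity
  rw [Finset.sum_const]
  simp only [Finset.card_univ, Fintype.card_fin, nsmul_eq_mul]
  obtain ⟨m, rfl⟩ : ∃ m, k = m + 1 := ⟨k - 1, by omega⟩
  simp only [Nat.add_sub_cancel]
  rw [pow_mul, pow_succ ((2:ℝ) ^ (m+1)) m]
  field_simp

lemma cons_sum (k : ℕ) (f : (Fin (k+1) → Bool) → ℝ) :
    ∑ e, f e = ∑ e : Fin k → Bool, (f (Fin.cons true e) + f (Fin.cons false e)) := by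
  rw [← (Fin.consEquiv (fun _ => Bool)).sum_comp, Fintype.sum_prod_type]
  simp [Finset.sum_add_distrib, Fin.consEquiv]

lemma XX_cons (k : ℕ) (a : Fin (k+1) → ℝ) (b : Bool) (e : Fin k → Bool) :
    XX (k+1) a (Fin.cons b e) = a 0 * sgn b + XX k (fun i => a i.succ) e := by
  simp [XX, Fin.sum_univ_succ]

lemma XX_sq (k : ℕ) (a : Fin k → ℝ) : ∑ e, XX k a e ^ 2 = 2 ^ k * ∑ i, a i ^ 2 := by
  induction k with
  | zero => simp [XX]
  | succ k ih =>
    rw [cons_sum]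
    simp only [XX_cons, sgn, if_true]
    rw [Fin.sum_univ_succ]
    have := ih (fun i => a i.succ)
    calc _ = ∑ e : Fin k → Bool, (2 * a 0 ^ 2 + 2 * XX k (fun i => a i.succ) e ^ 2) := by
          apply Finset.sum_congr rfl; intro e _; simp; ring
      _ = _ := by
          rw [Finset.sum_add_distrib, ← Finset.mul_sum (f := fun e => XX k (fun i => a i.succ) e ^ 2), this]; simp; ring

lemma XX_four (k : ℕ) (a : Fin k → ℝ) :
    ∑ e, XX k a e ^ 4 ≤ 2 ^ k * (3 * (∑ i, a i ^ 2) ^ 2) := by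
  induction k with
  | zero => simp [XX]
  | succ k ih =>
    rw [cons_sum]
    simp only [XX_cons, sgn, if_true]
    rw [Fin.sum_univ_succ]
    have := ih (fun i => a i.succ)
    have h2 := XX_sq k (fun i => a i.succ)
    calc _ = ∑ e : Fin k → Bool, (2 * a 0 ^ 4 + 12 * a 0 ^ 2 * XX k (fun i => a i.succ) e ^ 2
            + 2 * XX k (fun i => a i.succ) e ^ 4) := by
          apply Finset.sum_congr rfl; intro e _; simp; ring
      _ ≤ _ := by
          rw [Finset.sum_add_distrib, Finset.sum_add_distrib,
            ← Finset.mul_sum (f := fun e => XX k (fun i => a i.succ) e ^ 2),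
            ← Finset.mul_sum (f := fun e => XX k (fun i => a i.succ) e ^ 4), h2]
          simp only [Finset.sum_const, Finset.card_univ, Fintype.card_fun, Fintype.card_bool,
            Fintype.card_fin, nsmul_eq_mul]
          push_cast
          rw [pow_succ (2:ℝ) k]
          have h0 : 0 ≤ (2:ℝ)^k * a 0 ^ 4 := by positivity
          linear_combination 2 * this + 4 * h0

lemma mu_lower (k : ℕ) (a : Fin k → ℝ) (ha : ∑ i, a i ^ 2 = 1) : 9 / 16 ≤ mu k a := by
  have h2 := XX_sq k a
  have h4 := XX_four k a
  rw [ha] at h2 h4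
  unfold mu
  rw [le_div_iff₀ (by positivity)]
  calc _ ≤ ∑ e, (3 / 4 * XX k a e ^ 2 - 1 / 16 * XX k a e ^ 4) := by
        rw [Finset.sum_sub_distrib, ← Finset.mul_sum, ← Finset.mul_sum]; linarith
    _ ≤ _ := by
        apply Finset.sum_le_sum
        intro e _
        have h : XX k a e ^ 4 = |XX k a e| ^ 4 := (Even.pow_abs (by decide) _).symm
        rw [← sq_abs, h]
        have := abs_nonneg (XX k a e)
        generalize |XX k a e| = y at *
        have : 0 ≤ y * ((y - 2) ^ 2 * (y + 4)) := by positivity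
        nlinarith

lemma mu_upper (k : ℕ) (a : Fin k → ℝ) (t : ℝ) (ht : 0 < t) (ha : ∑ i, a i ^ 2 ≤ t ^ 2) :
    mu k a ≤ t := by
  have h2 := XX_sq k a
  unfold mu
  rw [div_le_iff₀ (by positivity)]
  have h : ∀ e, |XX k a e| ≤ (1 / (2 * t)) * XX k a e ^ 2 + t / 2 := by
    intro e
    rw [← sq_abs]
    generalize |XX k a e| = y
    have : (1 / (2 * t)) * y ^ 2 + t / 2 - y = (y - t) ^ 2 / (2 * t) := by field_simp; ring
    have : 0 ≤ (y - t) ^ 2 / (2 * t) := by positivity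
    linarith
  calc _ ≤ _ := Finset.sum_le_sum (fun e _ => h e)
    _ = 1 / (2 * t) * (2 ^ k * ∑ i, a i ^ 2) + 2 ^ k * (t / 2) := by
      rw [Finset.sum_add_distrib, ← Finset.mul_sum, h2]; simp
    _ ≤ 1 / (2 * t) * (2 ^ k * t ^ 2) + 2 ^ k * (t / 2) := by gcongr
    _ = _ := by field_simp; ring

lemma mu_nonneg (k : ℕ) (a : Fin k → ℝ) : 0 ≤ mu k a := by unfold mu; positivity

lemma exp_ptwise (l y : ℝ) (hl : |l| ≤ 1) :
    Real.exp (l * y) ≤ 1 + l * y + 2 * l ^ 2 * Real.exp (2 * |y|) := by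
  have h1 : Real.exp (l * y) ≤ 1 + l * y + |l * y| ^ 2 * Real.exp |l * y| := by
    have h := Complex.norm_exp_sub_sum_le_norm_mul_exp ((l * y : ℝ) : ℂ) 2
    simp only [Finset.sum_range_succ, Finset.sum_range_zero] at h
    rw [← Complex.ofReal_exp] at h
    have h' : ((Real.exp (l * y) : ℝ) : ℂ) - (0 + ((l * y : ℝ) : ℂ) ^ 0 / (Nat.factorial 0 : ℕ)
      + ((l * y : ℝ) : ℂ) ^ 1 / (Nat.factorial 1 : ℕ))
        = ((Real.exp (l * y) - (1 + l * y) : ℝ) : ℂ) := by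
      simp
    rw [h', Complex.norm_real, Complex.norm_real, Real.norm_eq_abs, Real.norm_eq_abs] at h
    linarith [le_abs_self (Real.exp (l * y) - (1 + l * y))]
  have h2 : |y| ^ 2 ≤ 2 * Real.exp |y| := by
    have := Real.quadratic_le_exp_of_nonneg (abs_nonneg y)
    nlinarith [abs_nonneg y]
  have h3 : Real.exp |l * y| ≤ Real.exp |y| := by
    apply Real.exp_le_exp.2; rw [abs_mul]; nlinarith [abs_nonneg y]
  have h4 : |l * y| ^ 2 * Real.exp |l * y| ≤ (l ^ 2 * (2 * Real.exp |y|)) * Real.exp |y| := by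
    rw [abs_mul, mul_pow, sq_abs l, ← abs_mul]
    gcongr
  have h5 : Real.exp (2 * |y|) = Real.exp |y| * Real.exp |y| := by
    rw [two_mul, Real.exp_add]
  rw [h5]; linarith

lemma dev_mgf (k : ℕ) (a : Fin k → ℝ) (ha : ∑ i, a i ^ 2 ≤ 1) (l : ℝ) (hl : |l| ≤ 1) :
    ∑ e, Real.exp (l * (|XX k a e| - mu k a)) ≤ 2 ^ k * Real.exp (4 * Real.exp 4 * l ^ 2) := by
  have hm1 := mu_upper k a 1 one_pos (by simpa using ha)
  have hm0 := mu_nonneg k a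
  have hsum : ∑ e, |XX k a e| = 2 ^ k * mu k a := by
    unfold mu; field_simp
  have hE := XX_abs_exp k a ha 2 (by norm_num)
  have h : ∀ e, Real.exp (l * (|XX k a e| - mu k a)) ≤ 1 + l * (|XX k a e| - mu k a)
      + 2 * l ^ 2 * Real.exp 2 * Real.exp (2 * |XX k a e|) := by
    intro e
    refine (exp_ptwise _ _ hl).trans ?_
    have : Real.exp (2 * |(|XX k a e| - mu k a)|) ≤ Real.exp 2 * Real.exp (2 * |XX k a e|) := by
      rw [← Real.exp_add]
      apply Real.exp_le_exp.2
      have := abs_nonneg (XX k a e)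
      rcases abs_cases (|XX k a e| - mu k a) with h | h <;> linarith
    have : 2 * l ^ 2 * Real.exp (2 * |(|XX k a e| - mu k a)|) ≤
        2 * l ^ 2 * (Real.exp 2 * Real.exp (2 * |XX k a e|)) := by gcongr
    linarith
  calc _ ≤ _ := Finset.sum_le_sum (fun e _ => h e)
    _ = 2 ^ k + 2 * l ^ 2 * Real.exp 2 * ∑ e, Real.exp (2 * |XX k a e|) := by
      rw [Finset.sum_add_distrib, Finset.sum_add_distrib, ← Finset.mul_sum, ← Finset.mul_sum,
        Finset.sum_sub_distrib, hsum]
      simp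
    _ ≤ 2 ^ k + 2 * l ^ 2 * Real.exp 2 * (2 ^ k * (2 * Real.exp (2 ^ 2 / 2))) := by gcongr
    _ = 2 ^ k * (4 * Real.exp 4 * l ^ 2 + 1) := by
      have : Real.exp 4 = Real.exp 2 * Real.exp 2 := by rw [← Real.exp_add]; norm_num
      rw [this]; norm_num; ring
    _ ≤ _ := by
      gcongr
      exact Real.add_one_le_exp _

lemma col_exp (k : ℕ) (hk : 0 < k) (a : Fin k → ℝ) (l m B : ℝ)
    (h : ∑ e, Real.exp (l * (|XX k a e| - m)) ≤ 2 ^ k * Real.exp B) :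
    ∑ ε, Real.exp (l * k * (FF k ε a - m)) ≤ 2 ^ (k * k) * Real.exp (B * k) := by
  have h1 := col_sum k (fun _ e => Real.exp (l * (|XX k a e| - m)))
  have h2 : ∀ ε : Fin k → Fin k → Bool, Real.exp (l * k * (FF k ε a - m))
      = ∏ j, Real.exp (l * (|XX k a (fun i => ε i j)| - m)) := by
    intro ε
    have hk' : (k : ℝ) ≠ 0 := by positivity
    rw [← Real.exp_sum, ← Finset.mul_sum, Finset.sum_sub_distrib]
    congr 1
    simp only [FF, XX, Finset.sum_const, Finset.card_univ, Fintype.card_fin, nsmul_eq_mul]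
    field_simp
  rw [Finset.sum_congr rfl (fun ε _ => h2 ε), h1]
  simp only [Finset.prod_const, Finset.card_univ, Fintype.card_fin]
  calc _ ≤ (2 ^ k * Real.exp B) ^ k := by gcongr
    _ = _ := by rw [mul_pow, ← pow_mul, ← Real.exp_nat_mul]; ring_nf

lemma roundOne (x h : ℝ) (hh : 0 < h) :
    ∃ n : ℤ, |(n : ℝ)| * h ≤ |x| ∧ |x - n * h| ≤ h ∧ |x - n * h| ≤ |x| := by
  have key : ∀ y : ℝ, 0 ≤ y → ∃ n : ℤ, 0 ≤ (n : ℝ) ∧ (n : ℝ) * h ≤ y ∧ y - n * h ≤ h := by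
    intro y hy
    refine ⟨⌊y / h⌋, ?_, ?_, ?_⟩
    · have : 0 ≤ ⌊y / h⌋ := Int.floor_nonneg.2 (by positivity)
      exact_mod_cast this
    · rw [← le_div_iff₀ hh]; exact Int.floor_le _
    · have := (Int.lt_floor_add_one (y / h)).le
      rw [div_le_iff₀ hh] at this
      linarith
  rcases le_total 0 x with hx | hx
  · obtain ⟨n, h0, h1, h2⟩ := key x hx
    have : 0 ≤ (n : ℝ) * h := by positivity
    refine ⟨n, ?_, ?_, ?_⟩
    · rw [abs_of_nonneg h0, abs_of_nonneg hx]; exact h1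
    · rw [abs_of_nonneg (by linarith)]; exact h2
    · rw [abs_of_nonneg (by linarith), abs_of_nonneg hx]; linarith
  · obtain ⟨n, h0, h1, h2⟩ := key (-x) (by linarith)
    have : 0 ≤ (n : ℝ) * h := by positivity
    refine ⟨-n, ?_, ?_, ?_⟩
    · push_cast; rw [abs_neg, abs_of_nonneg h0, abs_of_nonpos hx]; exact h1
    · push_cast; rw [abs_of_nonpos (by linarith)]; linarith
    · push_cast; rw [abs_of_nonpos (by linarith), abs_of_nonpos hx]; linarith

open scoped Classical in
/-- lattice net -/
noncomputable def Net (k : ℕ) (T : ℝ) : Finset (Fin k → ℤ) :=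
  (Fintype.piFinset (fun _ => Finset.Icc (-(⌈T⌉₊ : ℤ)) (⌈T⌉₊ : ℤ))).filter
    (fun n => ∑ i, |(n i : ℝ)| ≤ T)

lemma mem_Net (k : ℕ) (T : ℝ) (n : Fin k → ℤ) : n ∈ Net k T ↔ ∑ i, |(n i : ℝ)| ≤ T := by
  unfold Net
  rw [Finset.mem_filter, Fintype.mem_piFinset]
  refine ⟨fun h => h.2, fun h => ⟨fun i => ?_, h⟩⟩
  have h1 : |(n i : ℝ)| ≤ T :=
    (Finset.single_le_sum (f := fun i => |(n i : ℝ)|) (fun i _ => abs_nonneg _)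
      (Finset.mem_univ i)).trans h
  have h2 : |(n i : ℝ)| ≤ (⌈T⌉₊ : ℝ) := h1.trans (Nat.le_ceil T)
  have h3 : |n i| ≤ (⌈T⌉₊ : ℤ) := by exact_mod_cast h2
  rw [Finset.mem_Icc]
  exact abs_le.1 h3

lemma Icc_sum (q : ℝ) (hq : 0 < q) (hq2 : q ≤ 1 / 2) (N : ℕ) :
    ∑ m ∈ Finset.Icc (-(N : ℤ)) N, q ^ m.natAbs ≤ 1 + 4 * q - 4 * q * q ^ N := by
  induction N with
  | zero => simp
  | succ N ih =>
    have : Finset.Icc (-((N + 1 : ℕ) : ℤ)) ((N + 1 : ℕ) : ℤ) =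
        insert (-((N + 1 : ℕ) : ℤ)) (insert ((N + 1 : ℕ) : ℤ) (Finset.Icc (-(N : ℤ)) N)) := by
      ext x; simp only [Finset.mem_Icc, Finset.mem_insert]; omega
    rw [this, Finset.sum_insert, Finset.sum_insert]
    · rw [Int.natAbs_neg, Int.natAbs_natCast, pow_succ]
      have : 0 < q ^ N := by positivity
      nlinarith [mul_pos hq this, mul_nonneg (mul_pos hq this).le (sub_nonneg.2 hq2)]
    · simp
    · simp only [Finset.mem_insert, Finset.mem_Icc]; omega

lemma Net_card (k : ℕ) (T l : ℝ) (hl : 1 ≤ l) :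
    ((Net k T).card : ℝ) ≤ Real.exp (l * T + 4 * Real.exp (-l) * k) := by
  set q := Real.exp (-l) with hqd
  have hq : 0 < q := Real.exp_pos _
  have hq2 : q ≤ 1 / 2 := by
    have : q ≤ Real.exp (-1) := Real.exp_le_exp.2 (by linarith)
    have h2 : Real.exp (-1) < 0.3678794412 := Real.exp_neg_one_lt_d9
    norm_num at h2 ⊢
    linarith
  have h1 : ∀ n ∈ Net k T, (1 : ℝ) ≤ Real.exp (l * T) * ∏ i, q ^ (n i).natAbs := by
    intro n hn
    rw [mem_Net] at hn
    have : ∏ i, q ^ (n i).natAbs = Real.exp (-l * ∑ i, |(n i : ℝ)|) := by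
      rw [Finset.mul_sum, Real.exp_sum]
      apply Finset.prod_congr rfl
      intro i _
      rw [hqd, ← Real.exp_nat_mul, Nat.cast_natAbs]
      push_cast
      ring_nf
    rw [this, ← Real.exp_add]
    apply Real.one_le_exp
    nlinarith
  calc ((Net k T).card : ℝ) = ∑ n ∈ Net k T, 1 := by simp
    _ ≤ ∑ n ∈ Net k T, Real.exp (l * T) * ∏ i, q ^ (n i).natAbs := Finset.sum_le_sum h1
    _ ≤ ∑ n ∈ Fintype.piFinset (fun _ : Fin k => Finset.Icc (-(⌈T⌉₊ : ℤ)) (⌈T⌉₊ : ℤ)),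
        Real.exp (l * T) * ∏ i, q ^ (n i).natAbs := by
      apply Finset.sum_le_sum_of_subset_of_nonneg
      · exact Finset.filter_subset _ _
      · intros; positivity
    _ = Real.exp (l * T) * (∑ m ∈ Finset.Icc (-(⌈T⌉₊ : ℤ)) (⌈T⌉₊ : ℤ), q ^ m.natAbs) ^ k := by
      rw [← Finset.mul_sum, ← Finset.prod_univ_sum (fun _ : Fin k => Finset.Icc (-(⌈T⌉₊ : ℤ)) (⌈T⌉₊ : ℤ)) (fun _ m => q ^ m.natAbs)]
      simp
    _ ≤ Real.exp (l * T) * (Real.exp (4 * q)) ^ k := by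
      gcongr
      have := Icc_sum q hq hq2 ⌈T⌉₊
      have h3 : 0 ≤ 4 * q * q ^ ⌈T⌉₊ := by positivity
      linarith [Real.add_one_le_exp (4 * q)]
    _ = _ := by
      rw [← Real.exp_nat_mul, ← Real.exp_add]; ring_nf

lemma FF_add (k : ℕ) (ε) (a b : Fin k → ℝ) : FF k ε (a + b) ≤ FF k ε a + FF k ε b := by
  unfold FF
  rw [← mul_add, ← Finset.sum_add_distrib]
  gcongr with j
  simp only [Pi.add_apply, add_mul, Finset.sum_add_distrib]
  exact abs_add_le _ _

lemma FF_smul (k : ℕ) (ε) (s : ℝ) (a : Fin k → ℝ) : FF k ε (s • a) = |s| * FF k ε a := by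
  unfold FF
  simp only [Pi.smul_apply, smul_eq_mul, mul_assoc, ← Finset.mul_sum, abs_mul]
  ring

lemma FF_sub (k : ℕ) (ε) (a b : Fin k → ℝ) : |FF k ε a - FF k ε b| ≤ FF k ε (a - b) := by
  have h1 := FF_add k ε (a - b) b
  have h2 := FF_add k ε ((-1 : ℝ) • (a - b)) a
  rw [FF_smul] at h2
  simp at h1 h2
  rw [abs_le]; constructor <;> linarith

lemma mu_add (k : ℕ) (a b : Fin k → ℝ) : mu k (a + b) ≤ mu k a + mu k b := by
  unfold mu
  rw [← add_div, ← Finset.sum_add_distrib]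
  gcongr with e
  simp only [XX, Pi.add_apply, add_mul, Finset.sum_add_distrib]
  exact abs_add_le _ _

lemma mu_neg (k : ℕ) (a : Fin k → ℝ) : mu k (-a) = mu k a := by
  simp [mu, XX]

lemma mu_sub (k : ℕ) (a b : Fin k → ℝ) : |mu k a - mu k b| ≤ mu k (a - b) := by
  have h1 := mu_add k (a - b) b
  have h2 := mu_add k (-(a - b)) a
  rw [mu_neg] at h2
  simp at h1 h2
  rw [abs_le]; constructor <;> linarith

lemma FF_trivial (k : ℕ) (hk : 0 < k) (ε) (x : Fin k → ℝ) (hx : ∑ i, x i ^ 2 ≤ 1) :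
    FF k ε x ≤ k := by
  have hk' : (0 : ℝ) < k := by positivity
  have h1 : ∀ i, |x i| ≤ 1 := by
    intro i
    rw [← sq_le_one_iff_abs_le_one]
    exact (Finset.single_le_sum (f := fun i => x i ^ 2) (fun i _ => sq_nonneg _)
      (Finset.mem_univ i)).trans hx
  have h2 : ∀ j, |∑ i, x i * sgn (ε i j)| ≤ k := by
    intro j
    calc _ ≤ ∑ i, |x i * sgn (ε i j)| := Finset.abs_sum_le_sum_abs _ _
      _ ≤ ∑ i : Fin k, (1 : ℝ) := by
        apply Finset.sum_le_sum
        intro i _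
        rw [abs_mul]
        have : |sgn (ε i j)| = 1 := by unfold sgn; split <;> simp
        rw [this, mul_one]; exact h1 i
      _ = k := by simp
  unfold FF
  rw [inv_mul_le_iff₀ hk']
  calc _ ≤ ∑ j : Fin k, (k : ℝ) := Finset.sum_le_sum (fun j _ => h2 j)
    _ = _ := by simp

/-- lattice vector -/
def lat (k : ℕ) (h : ℝ) (n : Fin k → ℤ) : Fin k → ℝ := fun i => n i * h

lemma op_bound (k : ℕ) (hk : 0 < k) (ε)
    (H : ∀ n ∈ Net k (4 * k), ∑ i, lat k (2 * √k)⁻¹ n i ^ 2 ≤ 1 → FF k ε (lat k (2 * √k)⁻¹ n) ≤ 4) :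
    ∀ x : Fin k → ℝ, ∑ i, x i ^ 2 ≤ 1 → FF k ε x ≤ 8 := by
  have hk' : (0 : ℝ) < k := by positivity
  have hs : (0 : ℝ) < √k := Real.sqrt_pos.2 hk'
  have hss : √(k : ℝ) ^ 2 = k := Real.sq_sqrt hk'.le
  set h := (2 * √(k : ℝ))⁻¹ with hh
  have hpos : 0 < h := by positivity
  have hh2 : h ^ 2 = 1 / (4 * k) := by
    rw [hh, inv_pow, mul_pow, hss]; norm_num
  have key : ∀ m : ℕ, ∀ x : Fin k → ℝ, ∑ i, x i ^ 2 ≤ 1 → FF k ε x ≤ 8 + k * (1 / 2) ^ m := by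
    intro m
    induction m with
    | zero => intro x hx; have := FF_trivial k hk ε x hx; simp; linarith
    | succ m ih =>
      intro x hx
      choose n hn1 hn2 hn3 using fun i => roundOne (x i) h hpos
      have hsq : ∑ i, lat k h n i ^ 2 ≤ 1 := by
        refine le_trans (Finset.sum_le_sum fun i _ => ?_) hx
        rw [sq_le_sq]; unfold lat; rw [abs_mul, abs_of_pos hpos]; exact hn1 i
      have hmem : n ∈ Net k (4 * k) := by
        rw [mem_Net]
        have : ∑ i, lat k h n i ^ 2 = (∑ i, (n i : ℝ) ^ 2) * h ^ 2 := by
          simp [lat, mul_pow, Finset.sum_mul]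
        rw [this, hh2, mul_one_div, div_le_one (by positivity)] at hsq
        refine le_trans (Finset.sum_le_sum fun i _ => ?_) hsq
        have : |n i| ≤ (n i) ^ 2 := by
          rw [← Int.natCast_natAbs, ← Int.natAbs_sq]; exact_mod_cast Nat.le_self_pow (by norm_num) _
        exact_mod_cast this
      have hr : ∑ i, ((2 : ℝ) • (x - lat k h n)) i ^ 2 ≤ 1 := by
        calc _ ≤ ∑ i : Fin k, (1 / (k : ℝ)) := by
              apply Finset.sum_le_sum
              intro i _
              have h1 : (x i - n i * h) ^ 2 ≤ h ^ 2 := by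
                rw [sq_le_sq, abs_of_pos hpos]; exact hn2 i
              simp only [Pi.smul_apply, Pi.sub_apply, smul_eq_mul, lat, mul_pow]
              calc _ ≤ 2 ^ 2 * h ^ 2 := by gcongr
                _ = _ := by rw [hh2]; field_simp; norm_num
          _ = 1 := by simp; field_simp
      have h1 := ih _ hr
      rw [FF_smul] at h1
      have h2 := H n hmem hsq
      have h3 := FF_add k ε (x - lat k h n) (lat k h n)
      rw [abs_of_pos (by norm_num : (0:ℝ) < 2)] at h1
      rw [sub_add_cancel] at h3
      rw [pow_succ]
      linarith
  intro x hx
  have ht : Filter.Tendsto (fun m : ℕ => 8 + (k : ℝ) * (1 / 2) ^ m) Filter.atTop (nhds (8 + k * 0)) :=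
    ((tendsto_pow_atTop_nhds_zero_of_lt_one (by norm_num) (by norm_num)).const_mul _).const_add _
  have := ge_of_tendsto' ht (fun m => key m x hx)
  simpa using this

lemma op_bound' (k : ℕ) (ε) (H : ∀ x : Fin k → ℝ, ∑ i, x i ^ 2 ≤ 1 → FF k ε x ≤ 8)
    (t : ℝ) (ht : 0 < t) (x : Fin k → ℝ) (hx : ∑ i, x i ^ 2 ≤ t ^ 2) : FF k ε x ≤ 8 * t := by
  have h1 := H (t⁻¹ • x) (by
    simp only [Pi.smul_apply, smul_eq_mul, mul_pow, ← Finset.mul_sum]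
    rw [inv_pow, inv_mul_le_iff₀ (by positivity)]; linarith)
  rw [FF_smul, abs_of_pos (by positivity), inv_mul_le_iff₀ ht] at h1
  linarith

/-- Deterministic part. -/
lemma det_part (k : ℕ) (hk : 0 < k) (γ : ℝ) (hγ : 0 < γ) (hγ2 : γ ≤ (1 / 72) ^ 2) (ε)
    (H : ∀ n ∈ Net k (4 * k), ∑ i, lat k (2 * √k)⁻¹ n i ^ 2 ≤ 1 → FF k ε (lat k (2 * √k)⁻¹ n) ≤ 4)
    (H2 : ∀ n ∈ Net k (γ * k), ∑ i, lat k (√k)⁻¹ n i ^ 2 ≤ 1 →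
      |FF k ε (lat k (√k)⁻¹ n) - mu k (lat k (√k)⁻¹ n)| ≤ 1 / 8)
    (a : Fin k → ℝ) (ha : a ∈ Agk k γ) : |FF k ε a - mu k a| ≤ mu k a / 2 := by
  obtain ⟨ha1, ha2⟩ := ha
  have hk' : (0 : ℝ) < k := by positivity
  have hs : (0 : ℝ) < √k := Real.sqrt_pos.2 hk'
  have hss : √(k : ℝ) * √(k : ℝ) = k := Real.mul_self_sqrt hk'.le
  set h := (√(k : ℝ))⁻¹ with hh
  have hpos : 0 < h := by positivity
  have hhk : h * k = √k := by rw [hh]; field_simp; rw [sq, hss]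
  choose n hn1 hn2 hn3 using fun i => roundOne (a i) h hpos
  have hsq : ∑ i, lat k h n i ^ 2 ≤ 1 := by
    refine le_trans (Finset.sum_le_sum fun i _ => ?_) ha1.le
    rw [sq_le_sq]; unfold lat; rw [abs_mul, abs_of_pos hpos]; exact hn1 i
  have hmem : n ∈ Net k (γ * k) := by
    rw [mem_Net]
    have h1 : (∑ i, |(n i : ℝ)|) * h ≤ ∑ i, |a i| := by
      rw [Finset.sum_mul]; exact Finset.sum_le_sum fun i _ => hn1 i
    have h2 : h * ((∑ i, |(n i : ℝ)|) * h) ≤ γ := (mul_le_mul_of_nonneg_left h1 hpos.le).trans ha2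
    have h3 : h * h = 1 / k := by rw [hh, ← mul_inv, hss]; simp
    have h4 : h * ((∑ i, |(n i : ℝ)|) * h) = (∑ i, |(n i : ℝ)|) / k := by
      rw [mul_comm, mul_assoc, h3]; ring
    rw [h4, div_le_iff₀ hk'] at h2
    exact h2
  have hr : ∑ i, (a - lat k h n) i ^ 2 ≤ (1 / 72) ^ 2 := by
    refine le_trans ?_ hγ2
    refine le_trans ?_ ha2
    rw [Finset.mul_sum]
    apply Finset.sum_le_sum
    intro i _
    simp only [Pi.sub_apply, lat]
    rw [← sq_abs, sq]
    exact mul_le_mul (hn2 i) (hn3 i) (abs_nonneg _) hpos.le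
  have h1 := H2 n hmem hsq
  have h2 := op_bound' k ε (op_bound k hk ε H) (1 / 72) (by norm_num) _ hr
  have h3 := mu_upper k _ (1 / 72) (by norm_num) hr
  have h4 := FF_sub k ε a (lat k h n)
  have h5 := mu_sub k a (lat k h n)
  have h6 := mu_lower k a ha1
  rw [abs_le] at *
  constructor <;> linarith [h1.1, h1.2, h4.1, h4.2, h5.1, h5.2]

lemma Agk_large (k : ℕ) (hk : 0 < k) (γ : ℝ) (hγ : 0 < γ) (a : Fin k → ℝ) (ha : a ∈ Agk k γ) :
    1 ≤ γ ^ 2 * k := by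
  obtain ⟨ha1, ha2⟩ := ha
  have hk' : (0 : ℝ) < k := by positivity
  have hs : (0 : ℝ) < √k := Real.sqrt_pos.2 hk'
  have hss : √(k : ℝ) ^ 2 = k := Real.sq_sqrt hk'.le
  rw [inv_mul_le_iff₀ hs] at ha2
  have h1 : ∑ i, |a i| ^ 2 ≤ (∑ i, |a i|) ^ 2 :=
    Finset.sum_sq_le_sq_sum_of_nonneg (fun i _ => abs_nonneg _)
  simp only [sq_abs] at h1
  have h0 : 0 ≤ ∑ i, |a i| := by positivity
  have h2 : (∑ i, |a i|) ^ 2 ≤ (√k * γ) ^ 2 := by gcongr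
  rw [mul_pow, hss] at h2
  linarith

lemma markov (k : ℕ) (pred : (Fin k → Fin k → Bool) → Prop) (G : (Fin k → Fin k → Bool) → ℝ)
    (hG : ∀ ε, 0 ≤ G ε) (h : ∀ ε, pred ε → 1 ≤ G ε) :
    signProb k pred ≤ (∑ ε, G ε) / 2 ^ (k * k) := by
  classical
  unfold signProb
  gcongr
  rw [Finset.card_eq_sum_ones, Nat.cast_sum]
  calc _ ≤ ∑ ε ∈ Finset.univ.filter pred, G ε := by
        apply Finset.sum_le_sum
        intro ε hε
        simpa using h ε (Finset.mem_filter.1 hε).2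
    _ ≤ _ := Finset.sum_le_sum_of_subset_of_nonneg (Finset.filter_subset _ _) (fun _ _ _ => hG _)

lemma tail4 (k : ℕ) (hk : 0 < k) (b : Fin k → ℝ) (hb : ∑ i, b i ^ 2 ≤ 1) :
    ∑ ε, Real.exp (4 * k * (FF k ε b - 4)) ≤ 2 ^ (k * k) * Real.exp (-7 * k) := by
  apply col_exp k hk b 4 4 (-7)
  have h := XX_abs_exp k b hb 4 (by norm_num)
  have h1 : ∀ e, Real.exp (4 * (|XX k b e| - 4)) = Real.exp (-16) * Real.exp (4 * |XX k b e|) := by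
    intro e; rw [← Real.exp_add]; ring_nf
  simp only [h1]
  rw [← Finset.mul_sum]
  have h2 : (2 : ℝ) ≤ Real.exp 1 := by linarith [Real.add_one_le_exp 1]
  calc _ ≤ Real.exp (-16) * (2 ^ k * (2 * Real.exp (4 ^ 2 / 2))) := by gcongr
    _ ≤ Real.exp (-16) * (2 ^ k * (Real.exp 1 * Real.exp (4 ^ 2 / 2))) := by gcongr
    _ = 2 ^ k * (Real.exp (-16) * (Real.exp 1 * Real.exp (4 ^ 2 / 2))) := by ring
    _ = _ := by rw [← Real.exp_add, ← Real.exp_add]; norm_num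

lemma taildev (k : ℕ) (hk : 0 < k) (b : Fin k → ℝ) (hb : ∑ i, b i ^ 2 ≤ 1) (l : ℝ) (hl : |l| ≤ 1) :
    ∑ ε, Real.exp (l * k * (FF k ε b - mu k b) - |l| * k / 8)
      ≤ 2 ^ (k * k) * Real.exp ((4 * Real.exp 4 * l ^ 2 - |l| / 8) * k) := by
  have h := col_exp k hk b l (mu k b) _ (dev_mgf k b hb l hl)
  have h1 : ∀ ε, Real.exp (l * k * (FF k ε b - mu k b) - |l| * k / 8)
      = Real.exp (l * k * (FF k ε b - mu k b)) * Real.exp (- (|l| * k / 8)) := by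
    intro e; rw [← Real.exp_add]; ring_nf
  simp only [h1]
  rw [← Finset.sum_mul]
  calc _ ≤ _ := mul_le_mul_of_nonneg_right h (Real.exp_pos _).le
    _ = _ := by rw [mul_assoc, ← Real.exp_add]; ring_nf

open scoped Classical in
lemma prob_bound (k : ℕ) (hk : 0 < k) (γ l c : ℝ) (hγ : 0 < γ) (hγ2 : γ ≤ (1 / 72) ^ 2)
    (hl : 0 < l) (hl1 : l ≤ 1) (hc : 4 * Real.exp 4 * l ^ 2 - l / 8 = -c) :
    signProb k (fun ε => ∃ a ∈ Agk k γ,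
          |(k : ℝ)⁻¹ * ∑ j, |∑ i, a i * sgn (ε i j)| - E1 k a| > E1 k a / 2)
        ≤ (Net k (4 * k)).card * Real.exp (-7 * k) +
          (Net k (γ * k)).card * (2 * Real.exp (-c * k)) := by
  have hk' : (0 : ℝ) < k := by positivity
  set N1 := (Net k (4 * k)).filter (fun n => ∑ i, lat k (2 * √k)⁻¹ n i ^ 2 ≤ 1) with hN1
  set N2 := (Net k (γ * k)).filter (fun n => ∑ i, lat k (√k)⁻¹ n i ^ 2 ≤ 1) with hN2
  let G1 : (Fin k → Fin k → Bool) → (Fin k → ℤ) → ℝ := fun ε n =>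
    Real.exp (4 * k * (FF k ε (lat k (2 * √k)⁻¹ n) - 4))
  let G2 : ℝ → (Fin k → Fin k → Bool) → (Fin k → ℤ) → ℝ := fun l ε n =>
    Real.exp (l * k * (FF k ε (lat k (√k)⁻¹ n) - mu k (lat k (√k)⁻¹ n)) - |l| * k / 8)
  have hG1 : ∀ ε n, 0 ≤ G1 ε n := fun ε n => (Real.exp_pos _).le
  have hG2 : ∀ l ε n, 0 ≤ G2 l ε n := fun l ε n => (Real.exp_pos _).le
  have hM := markov k (fun ε => ∃ a ∈ Agk k γ,
          |(k : ℝ)⁻¹ * ∑ j, |∑ i, a i * sgn (ε i j)| - E1 k a| > E1 k a / 2)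
    (fun ε => ∑ n ∈ N1, G1 ε n + ∑ n ∈ N2, (G2 l ε n + G2 (-l) ε n))
    (fun ε => add_nonneg (Finset.sum_nonneg fun n _ => hG1 _ _)
      (Finset.sum_nonneg fun n _ => add_nonneg (hG2 _ _ _) (hG2 _ _ _)))
    (by
      rintro ε ⟨a, ha, hbad⟩
      by_contra hlt
      rw [not_le] at hlt
      have hs1 : 0 ≤ ∑ n ∈ N1, G1 ε n := Finset.sum_nonneg fun n _ => hG1 _ _
      have hs2 : 0 ≤ ∑ n ∈ N2, (G2 l ε n + G2 (-l) ε n) :=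
        Finset.sum_nonneg fun n _ => add_nonneg (hG2 _ _ _) (hG2 _ _ _)
      have := det_part k hk γ hγ hγ2 ε ?_ ?_ a ha
      · rw [← E1_eq k hk] at this
        exact absurd hbad (not_lt.2 this)
      · intro n hn hn'
        have hm : n ∈ N1 := Finset.mem_filter.2 ⟨hn, hn'⟩
        have h1 := Finset.single_le_sum (f := fun n => G1 ε n) (fun n _ => hG1 ε n) hm
        by_contra hcon
        rw [not_le] at hcon
        have : 1 ≤ G1 ε n := Real.one_le_exp (mul_nonneg (by positivity) (by linarith))
        linarith
      · intro n hn hn'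
        have hm : n ∈ N2 := Finset.mem_filter.2 ⟨hn, hn'⟩
        have h1 := Finset.single_le_sum (f := fun n => G2 l ε n + G2 (-l) ε n)
          (fun n _ => add_nonneg (hG2 _ _ _) (hG2 _ _ _)) hm
        have p1 := hG2 l ε n
        have p2 := hG2 (-l) ε n
        have hlk : 0 < l * k := by positivity
        rw [abs_le]
        constructor
        · by_contra hcon
          rw [not_le] at hcon
          have : 1 ≤ G2 (-l) ε n := by
            apply Real.one_le_exp
            rw [abs_neg, abs_of_pos hl]
            nlinarith
          linarith
        · by_contra hcon
          rw [not_le] at hcon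
          have : 1 ≤ G2 l ε n := by
            apply Real.one_le_exp
            rw [abs_of_pos hl]
            nlinarith
          linarith)
  refine hM.trans ?_
  rw [div_le_iff₀ (by positivity), Finset.sum_add_distrib, Finset.sum_comm,
    Finset.sum_comm (t := N2)]
  have b1 : ∀ n ∈ N1, ∑ ε, G1 ε n ≤ 2 ^ (k * k) * Real.exp (-7 * k) := fun n hn =>
    tail4 k hk _ (Finset.mem_filter.1 hn).2
  have b2 : ∀ n ∈ N2, ∑ ε, (G2 l ε n + G2 (-l) ε n) ≤ 2 ^ (k * k) * (2 * Real.exp (-c * k)) := by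
    intro n hn
    have hn' := (Finset.mem_filter.1 hn).2
    have t1 := taildev k hk _ hn' l (by rw [abs_of_pos hl]; exact hl1)
    have t2 := taildev k hk _ hn' (-l) (by rw [abs_neg, abs_of_pos hl]; exact hl1)
    rw [neg_sq, abs_neg, abs_of_pos hl, hc] at t2
    rw [abs_of_pos hl, hc] at t1
    rw [Finset.sum_add_distrib]
    simp only [G2, abs_neg, abs_of_pos hl]
    linarith
  have c1 : (N1.card : ℝ) ≤ (Net k (4 * k)).card := by
    exact Nat.cast_le.2 (Finset.card_filter_le _ _)
  have c2 : (N2.card : ℝ) ≤ (Net k (γ * k)).card := by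
    exact Nat.cast_le.2 (Finset.card_filter_le _ _)
  have d1 := Finset.sum_le_sum b1
  have d2 := Finset.sum_le_sum b2
  rw [Finset.sum_const, nsmul_eq_mul] at d1 d2
  have e1 := mul_le_mul_of_nonneg_right c1 (by positivity : 0 ≤ 2 ^ (k * k) * Real.exp (-7 * k))
  have e2 := mul_le_mul_of_nonneg_right c2
    (by positivity : 0 ≤ 2 ^ (k * k) * (2 * Real.exp (-c * k)))
  linarith

/-- There are absolute constants `0 < γ < 1` and `η > 0` such that for every positive
integer `k`,
`P(∃ a ∈ A_γ^k, |k⁻¹ ∑_j |∑_i a_i ε_{i,j}| − E₁(a)| > E₁(a)/2) ≤ e^{−η k}`. -/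
theorem stmt8 :
    ∃ γ η : ℝ, 0 < γ ∧ γ < 1 ∧ 0 < η ∧ ∀ k : ℕ, 0 < k →
      signProb k (fun ε => ∃ a ∈ Agk k γ,
          |(k : ℝ)⁻¹ * ∑ j, |∑ i, a i * sgn (ε i j)| - E1 k a| > E1 k a / 2)
        ≤ Real.exp (-(η * k)) := by
  have hK : (0 : ℝ) < Real.exp 4 := Real.exp_pos _
  have hK1 : (1 : ℝ) ≤ Real.exp 4 := Real.one_le_exp (by norm_num)
  obtain ⟨c, hcd⟩ : ∃ c : ℝ, c = 1 / (1024 * Real.exp 4) := ⟨_, rfl⟩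
  obtain ⟨l, hld⟩ : ∃ l : ℝ, l = 1 / (64 * Real.exp 4) := ⟨_, rfl⟩
  have hc0 : 0 < c := by rw [hcd]; positivity
  have hc1 : c ≤ 1 / 1024 := by
    rw [hcd]; apply one_div_le_one_div_of_le (by norm_num); linarith
  have hl0 : 0 < l := by rw [hld]; positivity
  have hl1 : l ≤ 1 := by
    rw [hld, div_le_one (by positivity)]; linarith
  have hlc : 4 * Real.exp 4 * l ^ 2 - l / 8 = -c := by
    rw [hld, hcd]; field_simp; norm_num
  refine ⟨c ^ 2 / 64, c / 4, by positivity, by nlinarith, by positivity, ?_⟩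
  intro k hk
  have hk' : (0 : ℝ) < k := by positivity
  by_cases hne : ∃ a, a ∈ Agk k (c ^ 2 / 64)
  · obtain ⟨a, ha⟩ := hne
    have hlarge := Agk_large k hk _ (by positivity) a ha
    have hck : 2 ≤ c * k / 4 := by
      have h3 : c ^ 3 ≤ 1 := pow_le_one₀ hc0.le (by linarith)
      have h4 : 0 < c * k := by positivity
      have h5 : c ^ 3 * (c * k) ≤ 1 * (c * k) := by gcongr
      nlinarith
    have hP := prob_bound k hk (c ^ 2 / 64) l c (by positivity) (by nlinarith) hl0 hl1 hlc
    refine hP.trans ?_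
    have n1 := Net_card k (4 * k) 1 le_rfl
    have n2 := Net_card k (c ^ 2 / 64 * k) (16 / c) (by rw [le_div_iff₀ hc0]; linarith)
    have q1 : Real.exp (-1) ≤ 1 / 2 := by
      have h2 : Real.exp (-1) < 0.3678794412 := Real.exp_neg_one_lt_d9
      norm_num at h2 ⊢
      linarith
    have q2 : Real.exp (-(16 / c)) ≤ c / 16 := by
      rw [Real.exp_neg, inv_le_comm₀ (Real.exp_pos _) (by positivity), inv_div]
      linarith [Real.add_one_le_exp (16 / c)]
    have n1' : ((Net k (4 * k)).card : ℝ) ≤ Real.exp (6 * k) :=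
      n1.trans (Real.exp_le_exp.2 (by nlinarith))
    have n2' : ((Net k (c ^ 2 / 64 * k)).card : ℝ) ≤ Real.exp (c / 2 * k) := by
      refine n2.trans (Real.exp_le_exp.2 ?_)
      have : 16 / c * (c ^ 2 / 64 * k) = c / 4 * k := by field_simp; norm_num
      rw [this]
      nlinarith
    calc _ ≤ Real.exp (6 * k) * Real.exp (-7 * k)
          + Real.exp (c / 2 * k) * (2 * Real.exp (-c * k)) := by gcongr
      _ = Real.exp (-k) + 2 * Real.exp (-(c / 2 * k)) := by
        rw [← Real.exp_add, mul_left_comm, ← Real.exp_add]; ring_nf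
      _ ≤ Real.exp (-(c / 2 * k)) + 2 * Real.exp (-(c / 2 * k)) := by
        gcongr; nlinarith
      _ = 3 * Real.exp (-(c / 2 * k)) := by ring
      _ ≤ Real.exp (c * k / 4) * Real.exp (-(c / 2 * k)) := by
        gcongr; linarith [Real.add_one_le_exp (c * k / 4)]
      _ = _ := by rw [← Real.exp_add]; ring_nf
  · have hM := markov k (fun ε => ∃ a ∈ Agk k (c ^ 2 / 64),
          |(k : ℝ)⁻¹ * ∑ j, |∑ i, a i * sgn (ε i j)| - E1 k a| > E1 k a / 2) (fun _ => 0)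
      (fun _ => le_rfl) (by rintro ε ⟨a, ha, -⟩; exact absurd ⟨a, ha⟩ hne)
    refine hM.trans ?_
    simp only [Finset.sum_const_zero, zero_div]
    positivity
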